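/- (Energy level strictly below the threshold) Let N ≥ 4, 2 < p < 2*, λ > 0 and μ > 0. Define A := K₁/2 - K₂/2* - K₃/2_*, and for ε > 0 and t > 0 set g_ε(t) := (t²/2) ∫_{ℝ^N_+} K|∇Ũ_ε|² dx - (μ λ^{(N-2)(2-p)/4} t^p / p) ∫_{ℝ^N_+} K Ũ_ε^p dx - (t^{2*}/2*) ∫_{ℝ^N_+} K Ũ_ε^{2*} dx - (t^{2_*}/2_*) ∫_{ℝ^{N-1}} K(x',0) Ũ_ε(x',0)^{2_*} dx'. Then there exists ε₀ > 0 such that for every ε ∈ (0, ε₀), sup_{t>0} g_ε(t) < A. -/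

import Mathlib

open MeasureTheory Real Topology Filter

noncomputable section

/-- `ℝ^N` as Euclidean space. -/
abbrev Euc (N : ℕ) := EuclideanSpace ℝ (Fin N)

/-- Gaussian-type weight `K(x) = exp(|x|²/4)`. -/
noncomputable def Kw {N : ℕ} (x : Euc N) : ℝ := Real.exp (‖x‖ ^ 2 / 4)

/-- critical Sobolev exponent `2* = 2N/(N-2)` -/
noncomputable def twoStar (N : ℕ) : ℝ := 2 * (N : ℝ) / ((N : ℝ) - 2)

/-- critical trace exponent `2_* = 2(N-1)/(N-2)` -/
noncomputable def twoStarL (N : ℕ) : ℝ := 2 * ((N : ℝ) - 1) / ((N : ℝ) - 2)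

/-- `i`-th partial derivative of `u` at `x` -/
noncomputable def pd {N : ℕ} (u : Euc N → ℝ) (i : Fin N) (x : Euc N) : ℝ :=
  fderiv ℝ u x (EuclideanSpace.single i 1)

/-- `|∇u(x)|²` -/
noncomputable def gradSq {N : ℕ} (u : Euc N → ℝ) (x : Euc N) : ℝ :=
  ∑ i, (pd u i x) ^ 2

/-- `x · ∇u(x)` -/
noncomputable def radial {N : ℕ} (u : Euc N → ℝ) (x : Euc N) : ℝ :=
  ∑ i, x i * pd u i x

/-- Laplacian `Δu(x)` -/
noncomputable def lap {N : ℕ} (u : Euc N → ℝ) (x : Euc N) : ℝ :=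
  ∑ i, pd (pd u i) i x

/-- index of the vertical coordinate `x_N` -/
def lastIdx (N : ℕ) (h : 0 < N) : Fin N := ⟨N - 1, by omega⟩

/-- open upper half-space `ℝ^N_+` -/
def upperHS (N : ℕ) (h : 0 < N) : Set (Euc N) := {x | 0 < x (lastIdx N h)}

/-- closed upper half-space -/
def upperHSc (N : ℕ) (h : 0 < N) : Set (Euc N) := {x | 0 ≤ x (lastIdx N h)}

/-- boundary hyperplane `∂ℝ^N_+` -/
def bdryHS (N : ℕ) (h : 0 < N) : Set (Euc N) := {x | x (lastIdx N h) = 0}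

/-- vertical derivative `∂u/∂x_N`, taken within the closed half-space -/
noncomputable def pdN (N : ℕ) (h : 0 < N) (u : Euc N → ℝ) (x : Euc N) : ℝ :=
  fderivWithin ℝ u (upperHSc N h) x (EuclideanSpace.single (lastIdx N h) 1)

/-- embedding of `ℝ^{N-1}` as the boundary of the half-space, `y ↦ (y, 0)` -/
noncomputable def emb (N : ℕ) (y : Euc (N - 1)) : Euc N :=
  (EuclideanSpace.equiv (Fin N) ℝ).symm
    (fun i => if hi : (i : ℕ) < N - 1 then y ⟨(i : ℕ), hi⟩ else 0)

/-- finite weighted energy, i.e. membership in the space `X` -/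
def FiniteEnergy (N : ℕ) (h : 0 < N) (u : Euc N → ℝ) : Prop :=
  IntegrableOn (fun x => Kw x * (gradSq u x + (u x) ^ 2)) (upperHS N h)

/-- classical solution of problem (1.1) -/
structure IsClassicalSolution (N : ℕ) (h : 0 < N) (lam mu p : ℝ) (u : Euc N → ℝ) : Prop where
  smooth2 : ContDiffOn ℝ 2 u (upperHS N h)
  smooth1 : ContDiffOn ℝ 1 u (upperHSc N h)
  pde : ∀ x ∈ upperHS N h,
    -lap u x - (1 / 2) * radial u x
      = lam * |u x| ^ (twoStar N - 2) * u x + mu * |u x| ^ (p - 2) * u x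
  bc : ∀ x ∈ bdryHS N h,
    -pdN N h u x = Real.sqrt lam * |u x| ^ (twoStarL N - 2) * u x

/-- `x_N⁰ = √(N/(N-2))` -/
noncomputable def xN0 (N : ℕ) : ℝ := Real.sqrt ((N : ℝ) / ((N : ℝ) - 2))

/-- `k_N = (N(N-2))^{(N-2)/4}` -/
noncomputable def kN (N : ℕ) : ℝ := ((N : ℝ) * ((N : ℝ) - 2)) ^ (((N : ℝ) - 2) / 4)

/-- `|x'|²`, squared norm of the horizontal part -/
noncomputable def horizSq {N : ℕ} (h : 0 < N) (x : Euc N) : ℝ :=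
  ∑ i ∈ Finset.univ.erase (lastIdx N h), (x i) ^ 2

/-- the family `φ_{ε,τ}` -/
noncomputable def bubbleT (N : ℕ) (h : 0 < N) (ε τ : ℝ) (x : Euc N) : ℝ :=
  (ε * Real.sqrt ((N : ℝ) * ((N : ℝ) - 2)) /
      (ε ^ 2 + horizSq h x + (x (lastIdx N h) + ε * τ * xN0 N) ^ 2)) ^ (((N : ℝ) - 2) / 2)

/-- the boundary bubble `U_ε = φ_{ε,1}` -/
noncomputable def Ubub (N : ℕ) (h : 0 < N) (ε : ℝ) (x : Euc N) : ℝ := bubbleT N h ε 1 x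

/-- `K₁ = ∫_{ℝ^N_+} |∇U_ε|²` (an `ε`-independent constant, computed at `ε = 1`) -/
noncomputable def Kone (N : ℕ) (h : 0 < N) : ℝ :=
  ∫ x in upperHS N h, gradSq (Ubub N h 1) x

/-- `K₂ = ∫_{ℝ^N_+} U_ε^{2*}` -/
noncomputable def Ktwo (N : ℕ) (h : 0 < N) : ℝ :=
  ∫ x in upperHS N h, (Ubub N h 1 x) ^ twoStar N

/-- `K₃ = ∫_{ℝ^{N-1}} U_ε(x',0)^{2_*}` -/
noncomputable def Kthree (N : ℕ) (h : 0 < N) : ℝ :=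
  ∫ y : Euc (N - 1), (Ubub N h 1 (emb N y)) ^ twoStarL N

/-- cut-off function: `φ ∈ C_c^∞(ℝ^N,[0,1])`, `φ ≡ 1` on `B₁(0)`, `φ ≡ 0` outside `B₂(0)` -/
structure IsCutoff (N : ℕ) (φ : Euc N → ℝ) : Prop where
  smooth : ContDiff ℝ (⊤ : ℕ∞) φ
  mem01 : ∀ x, φ x ∈ Set.Icc (0 : ℝ) 1
  eq_one : ∀ x ∈ Metric.closedBall (0 : Euc N) 1, φ x = 1
  eq_zero : ∀ x ∉ Metric.ball (0 : Euc N) 2, φ x = 0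

/-- truncated weighted bubble `Ũ_ε = K^{-1/2} φ U_ε` -/
noncomputable def Ut (N : ℕ) (h : 0 < N) (φ : Euc N → ℝ) (ε : ℝ) (x : Euc N) : ℝ :=
  (Kw x) ^ (-(1 : ℝ) / 2) * φ x * Ubub N h ε x

/-- smooth compactly supported test functions on the closed half-space -/
structure IsTestFun (N : ℕ) (h : 0 < N) (u : Euc N → ℝ) : Prop where
  smooth : ContDiff ℝ (⊤ : ℕ∞) u
  cpt : HasCompactSupport u
  supp : tsupport u ⊆ upperHSc N h

/-- the norm of the space `X`: `‖u‖ = (∫ K |∇u|²)^{1/2}` -/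
noncomputable def Xnorm (N : ℕ) (h : 0 < N) (u : Euc N → ℝ) : ℝ :=
  Real.sqrt (∫ x in upperHS N h, Kw x * gradSq u x)




/-- The denominator of the bubble. -/
def Dn (N : ℕ) (h : 0 < N) (ε : ℝ) (x : Euc N) : ℝ :=
  ε ^ 2 + horizSq h x + (x (lastIdx N h) + ε * xN0 N) ^ 2

/-- `√(N(N-2))` -/
def sN (N : ℕ) : ℝ := Real.sqrt ((N : ℝ) * ((N : ℝ) - 2))

/-- the shift vector -/
def bN (N : ℕ) (h : 0 < N) (ε : ℝ) : Euc N := (ε * xN0 N) • EuclideanSpace.single (lastIdx N h) 1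

lemma normSq_eq {N : ℕ} (h : 0 < N) (x : Euc N) :
    ‖x‖ ^ 2 = horizSq h x + x (lastIdx N h) ^ 2 := by
  rw [EuclideanSpace.norm_sq_eq, horizSq, ← Finset.sum_erase_add _ _ (Finset.mem_univ (lastIdx N h))]
  simp

lemma Dn_eq {N : ℕ} (h : 0 < N) (ε : ℝ) (x : Euc N) :
    Dn N h ε x = ε ^ 2 + ‖x + bN N h ε‖ ^ 2 := by
  rw [normSq_eq h, Dn, add_assoc]
  congr 2
  · unfold horizSq bN
    apply Finset.sum_congr rfl
    intro i hi
    have : i ≠ lastIdx N h := Finset.ne_of_mem_erase hi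
    simp [this]
  · simp [bN]

lemma xN0_nonneg (N : ℕ) : 0 ≤ xN0 N := Real.sqrt_nonneg _

lemma Dn_ge {N : ℕ} (h : 0 < N) {ε : ℝ} (hε : 0 < ε) {x : Euc N} (hx : 0 ≤ x (lastIdx N h)) :
    ε ^ 2 + ‖x‖ ^ 2 ≤ Dn N h ε x := by
  rw [normSq_eq h, Dn]
  have := mul_nonneg hε.le (xN0_nonneg N)
  nlinarith [mul_nonneg hx this]

lemma Dn_pos {N : ℕ} (h : 0 < N) {ε : ℝ} (hε : 0 < ε) (x : Euc N) : 0 < Dn N h ε x := by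
  rw [Dn_eq]; positivity

lemma Dn_ge' {N : ℕ} (h : 0 < N) {ε : ℝ} (x : Euc N) : ε ^ 2 ≤ Dn N h ε x := by
  rw [Dn_eq]; nlinarith [sq_nonneg ‖x + bN N h ε‖]

lemma Dn_cont {N : ℕ} (h : 0 < N) (ε : ℝ) : Continuous (Dn N h ε) := by
  have : Dn N h ε = fun x => ε ^ 2 + ‖x + bN N h ε‖ ^ 2 := funext (Dn_eq h ε)
  rw [this]; fun_prop

lemma Dn_smul {N : ℕ} (h : 0 < N) (ε : ℝ) (x : Euc N) :
    Dn N h ε (ε • x) = ε ^ 2 * Dn N h 1 x := by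
  simp only [Dn, horizSq, PiLp.smul_apply, smul_eq_mul, mul_pow, ← Finset.mul_sum]
  ring

lemma sN_pos {N : ℕ} (hN : 4 ≤ N) : 0 < sN N := by
  have : (4 : ℝ) ≤ N := by exact_mod_cast hN
  apply Real.sqrt_pos.2
  nlinarith

lemma Ubub_eq {N : ℕ} (h : 0 < N) (ε : ℝ) (x : Euc N) :
    Ubub N h ε x = (ε * sN N / Dn N h ε x) ^ (((N : ℝ) - 2) / 2) := by
  simp [Ubub, bubbleT, sN, Dn]

lemma Ubub_pos {N : ℕ} (hN : 4 ≤ N) (h : 0 < N) {ε : ℝ} (hε : 0 < ε) (x : Euc N) :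
    0 < Ubub N h ε x := by
  rw [Ubub_eq]
  have := sN_pos hN
  have := Dn_pos h hε x
  positivity

lemma Ubub_cont {N : ℕ} (hN : 4 ≤ N) (h : 0 < N) {ε : ℝ} (hε : 0 < ε) :
    Continuous (Ubub N h ε) := by
  have : Ubub N h ε = fun x => (ε * sN N / Dn N h ε x) ^ (((N : ℝ) - 2) / 2) :=
    funext (Ubub_eq h ε)
  rw [this]
  have h4 : (4 : ℝ) ≤ N := by exact_mod_cast hN
  apply Continuous.rpow_const
  · exact continuous_const.div (Dn_cont h ε) (fun x => (Dn_pos h hε x).ne')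
  · intro x; right; linarith

/-- powers of U in terms of D -/
lemma Ubub_rpow {N : ℕ} (hN : 4 ≤ N) (h : 0 < N) {ε : ℝ} (hε : 0 < ε) (x : Euc N) (q : ℝ) :
    Ubub N h ε x ^ q = (ε * sN N / Dn N h ε x) ^ (((N : ℝ) - 2) / 2 * q) := by
  have := sN_pos hN
  have := Dn_pos h hε x
  rw [Ubub_eq, ← Real.rpow_mul (by positivity)]

lemma Ubub_smul {N : ℕ} (hN : 4 ≤ N) (h : 0 < N) {ε : ℝ} (hε : 0 < ε) (x : Euc N) (q : ℝ) :
    Ubub N h ε (ε • x) ^ q = ε ^ (-(((N : ℝ) - 2) / 2 * q)) * Ubub N h 1 x ^ q := by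
  have h1 := sN_pos hN
  have h2 := Dn_pos h one_pos x
  rw [Ubub_rpow hN h hε, Ubub_rpow hN h one_pos, Dn_smul, Real.rpow_neg hε.le,
    ← Real.inv_rpow hε.le, ← Real.mul_rpow (by positivity) (by positivity)]
  congr 1
  field_simp

/-- `D * U^r = ε s U^(r - 2/(N-2))` -/
lemma Dn_mul_U {N : ℕ} (hN : 4 ≤ N) (h : 0 < N) {ε : ℝ} (hε : 0 < ε) (x : Euc N) (r : ℝ) :
    Dn N h ε x * Ubub N h ε x ^ r = ε * sN N * Ubub N h ε x ^ (r - 2 / ((N : ℝ) - 2)) := by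
  have h1 := sN_pos hN
  have h2 := Dn_pos h hε x
  have h4 : (4 : ℝ) ≤ N := by exact_mod_cast hN
  rw [Ubub_rpow hN h hε, Ubub_rpow hN h hε]
  have : ((N : ℝ) - 2) / 2 * r = ((N : ℝ) - 2) / 2 * (r - 2 / ((N : ℝ) - 2)) + 1 := by
    have : (N : ℝ) - 2 ≠ 0 := by linarith
    field_simp; ring
  rw [this, Real.rpow_add_one (by positivity)]
  field_simp

lemma gradSq_eq {N : ℕ} (u : Euc N → ℝ) (x : Euc N) : gradSq u x = ‖fderiv ℝ u x‖ ^ 2 := by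
  have := EuclideanSpace.norm_sq_eq ((InnerProductSpace.toDual ℝ (Euc N)).symm (fderiv ℝ u x))
  rw [LinearIsometryEquiv.norm_map] at this
  rw [this, gradSq]
  apply Finset.sum_congr rfl
  intro i _
  rw [pd, Real.norm_eq_abs, sq_abs]
  congr 1
  have h2 := InnerProductSpace.toDual_symm_apply (𝕜 := ℝ) (x := EuclideanSpace.single i (1:ℝ))
    (y := fderiv ℝ u x)
  rw [← h2, EuclideanSpace.inner_single_right]
  simp only [one_mul, conj_trivial]

lemma Ubub_hasFDerivAt {N : ℕ} (hN : 4 ≤ N) (h : 0 < N) {ε : ℝ} (hε : 0 < ε) (x : Euc N) :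
    HasFDerivAt (Ubub N h ε)
      ((-((N : ℝ) - 2) * Ubub N h ε x / Dn N h ε x) • innerSL ℝ (x + bN N h ε)) x := by
  have h1 := sN_pos hN
  have h2 := Dn_pos h hε x
  have hD : HasFDerivAt (Dn N h ε) (2 • innerSL ℝ (x + bN N h ε)) x := by
    have e : Dn N h ε = fun x => ε ^ 2 + ‖x + bN N h ε‖ ^ 2 := funext (Dn_eq h ε)
    rw [e]
    have := (((hasFDerivAt_id x).add_const (bN N h ε)).norm_sq).const_add (ε ^ 2)
    exact this.congr_fderiv (by ext v; simp)
  have e : Ubub N h ε = fun x => (ε * sN N) ^ (((N : ℝ) - 2) / 2) *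
      (Dn N h ε x) ^ (-(((N : ℝ) - 2) / 2)) := by
    funext y
    have := Dn_pos h hε y
    rw [Ubub_eq, Real.div_rpow (by positivity) (by positivity), Real.rpow_neg this.le]; rfl
  have := (hD.rpow_const (p := -(((N : ℝ) - 2) / 2)) (Or.inl h2.ne')).const_mul
    ((ε * sN N) ^ (((N : ℝ) - 2) / 2))
  rw [← e] at this
  refine this.congr_fderiv ?_
  rw [e]
  ext v
  simp only [ContinuousLinearMap.smul_apply, smul_eq_mul, nsmul_eq_mul,
    Real.rpow_sub_one h2.ne']
  simp
  ring

lemma fderiv_Ubub_norm {N : ℕ} (hN : 4 ≤ N) (h : 0 < N) {ε : ℝ} (hε : 0 < ε) (x : Euc N) :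
    ‖fderiv ℝ (Ubub N h ε) x‖ =
      ((N : ℝ) - 2) * Ubub N h ε x / Dn N h ε x * ‖x + bN N h ε‖ := by
  have h2 := Dn_pos h hε x
  have h3 := Ubub_pos hN h hε x
  have h4 : (4 : ℝ) ≤ N := by exact_mod_cast hN
  rw [(Ubub_hasFDerivAt hN h hε x).fderiv, norm_smul, innerSL_apply_norm, neg_mul, neg_div,
    norm_neg, Real.norm_of_nonneg]
  have : 0 ≤ (N : ℝ) - 2 := by linarith
  positivity

lemma gradSq_Ubub {N : ℕ} (hN : 4 ≤ N) (h : 0 < N) {ε : ℝ} (hε : 0 < ε) (x : Euc N) :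
    gradSq (Ubub N h ε) x =
      ((N : ℝ) - 2) ^ 2 * Ubub N h ε x ^ (2:ℝ) / Dn N h ε x ^ 2 * (Dn N h ε x - ε ^ 2) := by
  rw [gradSq_eq, fderiv_Ubub_norm hN h hε, mul_pow, div_pow, mul_pow, Real.rpow_two]
  congr 1
  rw [Dn_eq]; ring

lemma gradSq_Ubub_smul {N : ℕ} (hN : 4 ≤ N) (h : 0 < N) {ε : ℝ} (hε : 0 < ε) (x : Euc N) :
    gradSq (Ubub N h ε) (ε • x) = (ε ^ N)⁻¹ * gradSq (Ubub N h 1) x := by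
  have h2 := Dn_pos h one_pos x
  rw [gradSq_Ubub hN h hε, gradSq_Ubub hN h one_pos, Ubub_smul hN h hε, Dn_smul]
  have : ε ^ (-(((N:ℝ) - 2) / 2 * 2)) = (ε ^ N)⁻¹ * ε ^ 2 := by
    rw [← Real.rpow_natCast, ← Real.rpow_natCast, ← Real.rpow_neg hε.le, ← Real.rpow_add hε]
    congr 1; push_cast; ring
  rw [this]
  field_simp

open scoped Pointwise in
lemma upperHS_smul {N : ℕ} (h : 0 < N) {ε : ℝ} (hε : 0 < ε) :
    ε • upperHS N h = upperHS N h := by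
  ext x
  rw [Set.mem_smul_set_iff_inv_smul_mem₀ hε.ne']
  simp only [upperHS, Set.mem_setOf_eq, PiLp.smul_apply, smul_eq_mul]
  exact mul_pos_iff_of_pos_left (inv_pos.2 hε)

lemma upperHS_meas {N : ℕ} (h : 0 < N) : MeasurableSet (upperHS N h) := by
  apply IsOpen.measurableSet
  exact isOpen_lt continuous_const (by fun_prop)

lemma setInt_scale {N : ℕ} (h : 0 < N) {ε : ℝ} (hε : 0 < ε) (f : Euc N → ℝ) :
    ∫ x in upperHS N h, f x = ε ^ N * ∫ x in upperHS N h, f (ε • x) := by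
  have := Measure.setIntegral_comp_smul_of_pos volume f (upperHS N h) hε
  rw [this, upperHS_smul h hε]
  simp
  field_simp

lemma int_U_scale {N : ℕ} (hN : 4 ≤ N) (h : 0 < N) {ε : ℝ} (hε : 0 < ε) (q : ℝ) :
    ∫ x in upperHS N h, Ubub N h ε x ^ q =
      ε ^ ((N : ℝ) - ((N : ℝ) - 2) / 2 * q) * ∫ x in upperHS N h, Ubub N h 1 x ^ q := by
  rw [setInt_scale h hε]
  simp_rw [Ubub_smul hN h hε]
  rw [integral_const_mul, ← mul_assoc, ← Real.rpow_natCast, ← Real.rpow_add hε]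
  rfl

lemma int_grad_scale {N : ℕ} (hN : 4 ≤ N) (h : 0 < N) {ε : ℝ} (hε : 0 < ε) :
    ∫ x in upperHS N h, gradSq (Ubub N h ε) x = Kone N h := by
  rw [setInt_scale h hε]
  simp_rw [gradSq_Ubub_smul hN h hε]
  rw [integral_const_mul, ← mul_assoc, mul_inv_cancel₀ (by positivity), one_mul]
  rfl

lemma U_integrable {N : ℕ} (hN : 4 ≤ N) (h : 0 < N) {ε : ℝ} (hε : 0 < ε) (hε1 : ε ≤ 1) {q : ℝ}
    (hq : 2 < q) : IntegrableOn (fun x => Ubub N h ε x ^ q) (upperHS N h) := by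
  have h1 := sN_pos hN
  have h4 : (4 : ℝ) ≤ N := by exact_mod_cast hN
  have hi : Integrable (fun x : Euc N => (1 + ‖x‖ ^ 2) ^ (-(((N : ℝ) - 2) * q) / 2)) volume := by
    apply integrable_rpow_neg_one_add_norm_sq
    simp
    nlinarith
  have hi2 := (hi.const_mul ((sN N / ε) ^ (((N : ℝ) - 2) / 2 * q))).integrableOn (s := upperHS N h)
  refine Integrable.mono' hi2 ?_ ?_
  · apply Continuous.aestronglyMeasurable
    exact (Ubub_cont hN h hε).rpow_const (fun x => Or.inl (Ubub_pos hN h hε x).ne')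
  · filter_upwards [ae_restrict_mem (upperHS_meas h)] with x hx
    have h2 := Dn_pos h hε x
    have h3 := Dn_ge h hε (le_of_lt hx)
    rw [Real.norm_of_nonneg (Real.rpow_nonneg (Ubub_pos hN h hε x).le _), Ubub_rpow hN h hε]
    have e : -(((N : ℝ) - 2) * q) / 2 = -(((N : ℝ) - 2) / 2 * q) := by ring
    rw [e, Real.rpow_neg (by positivity), ← Real.inv_rpow (by positivity),
      ← Real.mul_rpow (by positivity) (by positivity)]
    apply Real.rpow_le_rpow (by positivity) _ (by nlinarith)
    rw [← div_eq_mul_inv, div_div, div_le_div_iff₀ h2 (by positivity)]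
    have : ε ^ 2 * (1 + ‖x‖ ^ 2) ≤ Dn N h ε x := by
      nlinarith [mul_nonneg (sub_nonneg.2 (show ε ^ 2 ≤ 1 by nlinarith)) (sq_nonneg ‖x‖)]
    nlinarith

lemma grad_integrable {N : ℕ} (hN : 4 ≤ N) (h : 0 < N) {ε : ℝ} (hε : 0 < ε) (hε1 : ε ≤ 1) :
    IntegrableOn (fun x => gradSq (Ubub N h ε) x) (upperHS N h) := by
  have h1 := sN_pos hN
  have h4 : (4 : ℝ) ≤ N := by exact_mod_cast hN
  have hm : 0 < (N : ℝ) - 2 := by linarith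
  have hq : (2:ℝ) < 2 + 2 / ((N : ℝ) - 2) := by
    have : 0 < 2 / ((N : ℝ) - 2) := by positivity
    linarith
  have hi := (U_integrable hN h hε hε1 hq).const_mul (((N : ℝ) - 2) ^ 2 / (ε * sN N))
  refine Integrable.mono' hi ?_ ?_
  · apply Continuous.aestronglyMeasurable
    simp_rw [gradSq_Ubub hN h hε]
    have := Ubub_cont hN h hε
    have := Dn_cont h ε
    have hh : ∀ x, Dn N h ε x ^ 2 ≠ 0 := fun x => pow_ne_zero _ (Dn_pos h hε x).ne'
    have : Continuous fun x => Ubub N h ε x ^ (2:ℝ) := 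
      (Ubub_cont hN h hε).rpow_const (fun x => Or.inl (Ubub_pos hN h hε x).ne')
    fun_prop (disch := exact hh)
  · refine Filter.Eventually.of_forall fun x => ?_
    have h2 := Dn_pos h hε x
    have h3 := Ubub_pos hN h hε x
    rw [gradSq_eq, Real.norm_of_nonneg (by positivity), ← gradSq_eq, gradSq_Ubub hN h hε]
    have := Dn_mul_U hN h hε x (2 + 2 / ((N : ℝ) - 2))
    rw [add_sub_cancel_right] at this
    have e : Ubub N h ε x ^ (2 + 2 / ((N : ℝ) - 2)) = ε * sN N * Ubub N h ε x ^ (2:ℝ) / Dn N h ε x := by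
      rw [← this]; field_simp
    rw [e]
    have : Dn N h ε x - ε ^ 2 ≤ Dn N h ε x := by nlinarith [sq_nonneg ε]
    calc _ ≤ ((N : ℝ) - 2) ^ 2 * Ubub N h ε x ^ (2:ℝ) / Dn N h ε x ^ 2 * Dn N h ε x := by gcongr
      _ = _ := by field_simp


lemma emb_apply (N : ℕ) (y : Euc (N - 1)) (i : Fin N) :
    emb N y i = if hi : (i : ℕ) < N - 1 then y ⟨(i : ℕ), hi⟩ else 0 := rfl

lemma emb_last {N : ℕ} (h : 0 < N) (y : Euc (N - 1)) : emb N y (lastIdx N h) = 0 := by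
  rw [emb_apply]; simp [lastIdx]

lemma emb_norm (N : ℕ) (h : 0 < N) (y : Euc (N - 1)) : ‖emb N y‖ ^ 2 = ‖y‖ ^ 2 := by
  obtain ⟨n, rfl⟩ : ∃ n, N = n + 1 := ⟨N - 1, by omega⟩
  rw [EuclideanSpace.norm_sq_eq, EuclideanSpace.norm_sq_eq, Fin.sum_univ_castSucc]
  have : emb (n + 1) y (Fin.last n) = 0 := emb_last h y
  rw [this]
  simp only [norm_zero, ne_eq, OfNat.ofNat_ne_zero, not_false_eq_true, zero_pow, add_zero]
  apply Finset.sum_congr rfl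
  intro i _
  rw [emb_apply]
  simp

lemma emb_smul (N : ℕ) (c : ℝ) (y : Euc (N - 1)) : emb N (c • y) = c • emb N y := by
  ext i
  rw [PiLp.smul_apply, emb_apply, emb_apply]
  split_ifs <;> simp

lemma emb_cont (N : ℕ) : Continuous (emb N) := by
  unfold emb
  apply (EuclideanSpace.equiv (Fin N) ℝ).symm.continuous.comp
  apply continuous_pi
  intro i
  split_ifs <;> fun_prop

lemma Dn_emb {N : ℕ} (h : 0 < N) (ε : ℝ) (y : Euc (N - 1)) :
    Dn N h ε (emb N y) = ε ^ 2 * (1 + xN0 N ^ 2) + ‖y‖ ^ 2 := by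
  have := normSq_eq h (emb N y)
  rw [emb_norm N h, emb_last h] at this
  rw [Dn, emb_last h, this]; ring

lemma int_bU_scale {N : ℕ} (hN : 4 ≤ N) (h : 0 < N) {ε : ℝ} (hε : 0 < ε) (q : ℝ) :
    ∫ y, Ubub N h ε (emb N y) ^ q =
      ε ^ ((N : ℝ) - 1 - ((N : ℝ) - 2) / 2 * q) * ∫ y, Ubub N h 1 (emb N y) ^ q := by
  have := Measure.integral_comp_smul volume (fun y : Euc (N - 1) => Ubub N h ε (emb N y) ^ q) ε
  simp_rw [emb_smul, Ubub_smul hN h hε] at this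
  rw [integral_const_mul] at this
  simp only [finrank_euclideanSpace, Fintype.card_fin, smul_eq_mul] at this
  rw [abs_of_pos (by positivity), eq_inv_mul_iff_mul_eq₀ (by positivity)] at this
  rw [← this, ← mul_assoc, ← Real.rpow_natCast, ← Real.rpow_add hε]
  congr 2
  rw [Nat.cast_sub (by omega)]; push_cast; ring

lemma bU_integrable {N : ℕ} (hN : 4 ≤ N) (h : 0 < N) {ε : ℝ} (hε : 0 < ε) (hε1 : ε ≤ 1) {q : ℝ}
    (hq : 2 ≤ q) : Integrable (fun y => Ubub N h ε (emb N y) ^ q) := by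
  have h1 := sN_pos hN
  have h4 : (4 : ℝ) ≤ N := by exact_mod_cast hN
  have hi : Integrable (fun x : Euc (N - 1) => (1 + ‖x‖ ^ 2) ^ (-(((N : ℝ) - 2) * q) / 2)) volume := by
    apply integrable_rpow_neg_one_add_norm_sq
    simp only [finrank_euclideanSpace, Fintype.card_fin]
    rw [Nat.cast_sub (by omega)]
    push_cast
    nlinarith
  have hi2 := (hi.const_mul ((sN N / ε) ^ (((N : ℝ) - 2) / 2 * q)))
  refine Integrable.mono' hi2 ?_ ?_
  · apply Continuous.aestronglyMeasurable
    exact ((Ubub_cont hN h hε).comp (emb_cont N)).rpow_const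
      (fun x => Or.inl (Ubub_pos hN h hε _).ne')
  · refine Filter.Eventually.of_forall fun x => ?_
    have h2 := Dn_pos h hε (emb N x)
    have h3 := Dn_ge h hε (emb_last h x).ge
    rw [emb_norm N h] at h3
    rw [Real.norm_of_nonneg (Real.rpow_nonneg (Ubub_pos hN h hε _).le _), Ubub_rpow hN h hε]
    have e : -(((N : ℝ) - 2) * q) / 2 = -(((N : ℝ) - 2) / 2 * q) := by ring
    rw [e, Real.rpow_neg (by positivity), ← Real.inv_rpow (by positivity),
      ← Real.mul_rpow (by positivity) (by positivity)]
    apply Real.rpow_le_rpow (by positivity) _ (by nlinarith)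
    rw [← div_eq_mul_inv, div_div, div_le_div_iff₀ h2 (by positivity)]
    have : ε ^ 2 * (1 + ‖x‖ ^ 2) ≤ Dn N h ε (emb N x) := by
      nlinarith [mul_nonneg (sub_nonneg.2 (show ε ^ 2 ≤ 1 by nlinarith)) (sq_nonneg ‖x‖)]
    nlinarith

/-- Fubini on the half-space. -/
lemma fubini_HS (n : ℕ) (h : 0 < n + 1) (F : ℝ → ℝ → ℝ)
    (hf : IntegrableOn (fun x : Euc (n + 1) => F (horizSq h x) (x (lastIdx (n + 1) h)))
      (upperHS (n + 1) h)) :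
    ∫ x in upperHS (n + 1) h, F (horizSq h x) (x (lastIdx (n + 1) h)) =
      ∫ z in Set.Ioi (0 : ℝ), ∫ y : Euc n, F (‖y‖ ^ 2) z := by
  have e1 := (PiLp.volume_preserving_ofLp (Fin (n + 1)))
  have e2 := volume_preserving_piFinSuccAbove (fun _ : Fin (n + 1) => ℝ) (Fin.last n)
  have e3 := (MeasurePreserving.id (volume : Measure ℝ)).prod (PiLp.volume_preserving_toLp (Fin n))
  have e := e3.comp (e2.comp e1)
  set T : Euc (n + 1) → ℝ × Euc n := Prod.map id (WithLp.toLp 2) ∘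
    (MeasurableEquiv.piFinSuccAbove (fun _ : Fin (n + 1) => ℝ) (Fin.last n)) ∘ WithLp.ofLp with hT
  have hemb : MeasurableEmbedding T := by
    refine MeasurableEmbedding.comp ?_ (MeasurableEmbedding.comp (MeasurableEquiv.measurableEmbedding _) ?_)
    · exact ((MeasurableEquiv.refl ℝ).prodCongr (MeasurableEquiv.toLp 2 (Fin n → ℝ))).measurableEmbedding
    · exact (MeasurableEquiv.toLp 2 (Fin (n+1) → ℝ)).symm.measurableEmbedding
  have hl : lastIdx (n + 1) h = Fin.last n := rfl
  have hT1 : ∀ x, (T x).1 = x (Fin.last n) := fun x => rfl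
  have hT2 : ∀ x, ‖(T x).2‖ ^ 2 = horizSq h x := by
    intro x
    have h2 : horizSq h x = ∑ i : Fin n, x i.castSucc ^ 2 := by
      have := normSq_eq h x
      rw [EuclideanSpace.norm_sq_eq, Fin.sum_univ_castSucc, hl] at this
      simp only [Real.norm_eq_abs, sq_abs] at this
      linarith
    rw [h2, EuclideanSpace.norm_sq_eq]
    apply Finset.sum_congr rfl
    intro i _
    rw [Real.norm_eq_abs, sq_abs]
    congr 1
    change x ((Fin.last n).succAbove i) = _
    rw [Fin.succAbove_last]
  have hpre : upperHS (n + 1) h = T ⁻¹' (Set.Ioi 0 ×ˢ Set.univ) := by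
    ext x
    simp [upperHS, hT1, hl]
  have hfun : (fun x : Euc (n + 1) => F (horizSq h x) (x (lastIdx (n + 1) h))) =
      fun x => (fun p : ℝ × Euc n => F (‖p.2‖ ^ 2) p.1) (T x) := by
    funext x
    simp only [hT1, hT2, hl]
  rw [hfun, hpre] at hf
  have hf2 := (e.integrableOn_comp_preimage (f := fun p : ℝ × Euc n => F (‖p.2‖ ^ 2) p.1) hemb).1 hf
  rw [hfun, hpre, e.setIntegral_preimage_emb hemb (fun p : ℝ × Euc n => F (‖p.2‖ ^ 2) p.1),
    setIntegral_prod _ hf2]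
  simp


lemma base_int (n : ℕ) {s : ℝ} (hs : (n : ℝ) < 2 * s) :
    Integrable (fun y : Euc n => (1 + ‖y‖ ^ 2) ^ (-s)) := by
  have : Integrable (fun y : Euc n => (1 + ‖y‖ ^ 2) ^ (-(2 * s) / 2)) := by
    apply integrable_rpow_neg_one_add_norm_sq
    simpa using hs
  convert this using 3
  ring

lemma J_scale (n : ℕ) (s : ℝ) {a : ℝ} (ha : 0 < a) :
    ∫ y : Euc n, (a + ‖y‖ ^ 2) ^ (-s) = a ^ ((n : ℝ) / 2 - s) * ∫ y : Euc n, (1 + ‖y‖ ^ 2) ^ (-s) := by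
  have := Measure.integral_comp_smul volume (fun y : Euc n => (a + ‖y‖ ^ 2) ^ (-s)) (√a)
  have e : ∀ y : Euc n, (a + ‖√a • y‖ ^ 2) ^ (-s) = a ^ (-s) * (1 + ‖y‖ ^ 2) ^ (-s) := by
    intro y
    rw [norm_smul, mul_pow, Real.norm_of_nonneg (Real.sqrt_nonneg a), Real.sq_sqrt ha.le,
      ← Real.mul_rpow ha.le (by positivity)]
    congr 1; ring
  simp_rw [e] at this
  rw [integral_const_mul] at this
  simp only [finrank_euclideanSpace, Fintype.card_fin, smul_eq_mul] at this
  have hs : 0 < √a := Real.sqrt_pos.2 ha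
  rw [abs_of_pos (by positivity), eq_inv_mul_iff_mul_eq₀ (by positivity)] at this
  rw [← this, ← mul_assoc, sub_eq_add_neg, Real.rpow_add ha, Real.sqrt_eq_rpow, ← Real.rpow_natCast,
    ← Real.rpow_mul ha.le]
  congr 3
  ring

lemma J_half (n : ℕ) (hn : 1 ≤ n) :
    ∫ y : Euc n, (1 + ‖y‖ ^ 2) ^ (-((n : ℝ) + 1)) = (∫ y : Euc n, (1 + ‖y‖ ^ 2) ^ (-(n : ℝ))) / 2 := by
  have hn' : (1 : ℝ) ≤ n := by exact_mod_cast hn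
  have i1 := base_int n (s := (n : ℝ) + 1) (by linarith)
  have i2 := base_int n (s := (n : ℝ)) (by linarith)
  set G : ℝ → ℝ := fun r => 2 * (1 + r ^ 2) ^ (-((n : ℝ) + 1)) - (1 + r ^ 2) ^ (-(n : ℝ)) with hG
  have hGi : Integrable (fun y : Euc n => G ‖y‖) := (i1.const_mul 2).sub i2
  have : Nonempty (Fin n) := ⟨⟨0, by omega⟩⟩
  have : Nontrivial (Euc n) := inferInstance
  have hI := (integrable_fun_norm_addHaar (μ := (volume : Measure (Euc n))) (f := G)).1 hGi
  have key : ∫ y : Euc n, G ‖y‖ = 0 := by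
    rw [integral_fun_norm_addHaar]
    have : ∫ r in Set.Ioi (0 : ℝ), (n : ℝ) * (r ^ (n - 1) * G r) = 0 - (fun r : ℝ => (r / (1 + r ^ 2)) ^ n) 0 := by
      refine integral_Ioi_of_hasDerivAt_of_tendsto
        (f := fun r : ℝ => (r / (1 + r ^ 2)) ^ n) ?_ ?_ ?_ ?_
      · apply Continuous.continuousWithinAt
        have : ∀ r : ℝ, 1 + r ^ 2 ≠ 0 := fun r => by positivity
        fun_prop (disch := exact this)
      · intro r hr
        have hp : 1 + r ^ 2 ≠ 0 := by positivity
        have h1 : HasDerivAt (fun r : ℝ => 1 + r ^ 2) (2 * r) r := by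
          simpa using (hasDerivAt_pow 2 r).const_add 1
        have h2 := (((hasDerivAt_id r).div h1 hp).pow n)
        refine h2.congr_deriv ?_
        simp only [hG, id, Pi.div_apply]
        rw [Real.rpow_neg (by positivity), Real.rpow_neg (by positivity), Real.rpow_natCast,
          ← Nat.cast_add_one, Real.rpow_natCast]
        obtain ⟨k, rfl⟩ : ∃ k, n = k + 1 := ⟨n - 1, by omega⟩
        simp only [Nat.add_sub_cancel, div_pow]
        field_simp
        ring
      · refine Integrable.const_mul ?_ _
        simpa [IntegrableOn] using hI
      · have t1 : Tendsto (fun r : ℝ => r / (1 + r ^ 2)) atTop (𝓝 0) := by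
          apply squeeze_zero' (g := fun r : ℝ => r⁻¹)
          · filter_upwards [eventually_gt_atTop 0] with r hr
            positivity
          · filter_upwards [eventually_gt_atTop 0] with r hr
            rw [div_le_iff₀ (by positivity)]
            field_simp
            nlinarith
          · exact tendsto_inv_atTop_zero
        have := t1.pow n
        rwa [zero_pow (by omega)] at this
    rw [integral_const_mul] at this
    simp only [zero_div, ne_eq, zero_pow (show n ≠ 0 by omega), sub_zero] at this
    have h0 := (mul_eq_zero.1 this).resolve_left (by positivity)
    simp [h0]
  have : ∫ y : Euc n, G ‖y‖ = 2 * (∫ y : Euc n, (1 + ‖y‖ ^ 2) ^ (-((n : ℝ) + 1))) -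
      ∫ y : Euc n, (1 + ‖y‖ ^ 2) ^ (-(n : ℝ)) := by
    rw [← integral_const_mul, ← integral_sub (i1.const_mul 2) i2]
  linarith

lemma line_int {q : ℝ} (c : ℝ) (hq : 1 < 2 * q) :
    IntegrableOn (fun z : ℝ => (1 + (z + c) ^ 2) ^ (-q)) (Set.Ioi 0) := by
  have : Integrable (fun y : ℝ => (1 + ‖y‖ ^ 2) ^ (-(2 * q) / 2)) := by
    apply integrable_rpow_neg_one_add_norm_sq
    simpa using hq
  have h2 := (this.comp_add_right c).integrableOn (s := Set.Ioi 0)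
  convert h2 using 3 with z
  · simp
  · ring

lemma line_ident (n : ℝ) (hn : 3 ≤ n) (c : ℝ) :
    (n - 1) * (∫ z in Set.Ioi (0:ℝ), (1 + (z + c) ^ 2) ^ (-(n / 2)))
      - n * (∫ z in Set.Ioi (0:ℝ), (1 + (z + c) ^ 2) ^ (-(n / 2 + 1)))
      = c * (1 + c ^ 2) ^ (-(n / 2)) := by
  have i1 := line_int (q := n / 2) c (by linarith)
  have i2 := line_int (q := n / 2 + 1) c (by linarith)
  have : ∫ z in Set.Ioi (0:ℝ), ((n - 1) * (1 + (z + c) ^ 2) ^ (-(n / 2)) -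
      n * (1 + (z + c) ^ 2) ^ (-(n / 2 + 1))) =
      0 - (fun z : ℝ => -((z + c) * (1 + (z + c) ^ 2) ^ (-(n / 2)))) 0 := by
    have hp : ∀ z : ℝ, 0 < 1 + (z + c) ^ 2 := fun z => by positivity
    have hd : ∀ z : ℝ, HasDerivAt (fun z : ℝ => -((z + c) * (1 + (z + c) ^ 2) ^ (-(n / 2))))
        ((n - 1) * (1 + (z + c) ^ 2) ^ (-(n / 2)) -
          n * (1 + (z + c) ^ 2) ^ (-(n / 2 + 1))) z := by
      intro z
      have h0 : HasDerivAt (fun z : ℝ => z + c) 1 z := (hasDerivAt_id z).add_const c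
      have h1 : HasDerivAt (fun z : ℝ => 1 + (z + c) ^ 2) (2 * (z + c)) z := by
        simpa using (h0.pow 2).const_add 1
      have h2 := (h0.mul (h1.rpow_const (p := -(n / 2)) (Or.inl (hp z).ne'))).neg
      refine h2.congr_deriv ?_
      have e : -(n / 2 + 1) = -(n / 2) - 1 := by ring
      rw [e, Real.rpow_sub_one (hp z).ne']
      have := (hp z).ne'
      field_simp
      ring
    refine integral_Ioi_of_hasDerivAt_of_tendsto
      (f := fun z : ℝ => -((z + c) * (1 + (z + c) ^ 2) ^ (-(n / 2)))) ?_ ?_ ?_ ?_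
    · exact (hd 0).continuousAt.continuousWithinAt
    · intro z _; exact hd z
    · exact (i1.const_mul _).sub (i2.const_mul _)
    · rw [← neg_zero]
      apply Tendsto.neg
      have t0 : Tendsto (fun z : ℝ => z + c) atTop atTop := tendsto_atTop_add_const_right _ _ tendsto_id
      apply squeeze_zero' (g := fun z : ℝ => (z + c)⁻¹)
      · filter_upwards [t0.eventually_gt_atTop 0] with z hz
        positivity
      · filter_upwards [t0.eventually_gt_atTop 0] with z hz
        have : (1 + (z + c) ^ 2) ^ (-(n / 2)) ≤ (1 + (z + c) ^ 2) ^ (-1 : ℝ) := by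
          apply Real.rpow_le_rpow_of_exponent_le
          · nlinarith
          · linarith
        rw [Real.rpow_neg_one] at this
        calc _ ≤ (z + c) * (1 + (z + c) ^ 2)⁻¹ := by gcongr
          _ ≤ _ := by
            rw [← div_eq_mul_inv, div_le_iff₀ (hp z)]
            field_simp
            nlinarith
      · exact tendsto_inv_atTop_zero.comp t0
  rw [integral_sub (i1.const_mul _) (i2.const_mul _), integral_const_mul, integral_const_mul] at this
  rw [this]
  simp

/-- The half space integral of powers of `D`. -/
lemma HS_int (n : ℕ) (h : 0 < n + 1) (s : ℝ) (hs : (n : ℝ) + 1 < 2 * s) :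
    IntegrableOn (fun x : Euc (n+1) => Dn (n+1) h 1 x ^ (-s)) (upperHS (n+1) h) ∧
    ∫ x in upperHS (n+1) h, Dn (n+1) h 1 x ^ (-s) =
      (∫ z in Set.Ioi (0:ℝ), (1 + (z + xN0 (n+1)) ^ 2) ^ (-(s - (n : ℝ) / 2)))
       * ∫ y : Euc n, (1 + ‖y‖ ^ 2) ^ (-s) := by
  have hI : IntegrableOn (fun x : Euc (n+1) => Dn (n+1) h 1 x ^ (-s)) (upperHS (n+1) h) := by
    have := ((base_int (n+1) (s := s) (by push_cast; linarith)).comp_add_right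
      (bN (n+1) h 1)).integrableOn (s := upperHS (n+1) h)
    simp_rw [Dn_eq]
    simpa using this
  refine ⟨hI, ?_⟩
  have := fubini_HS n h (fun a z => (1 ^ 2 + a + (z + 1 * xN0 (n+1)) ^ 2) ^ (-s)) hI
  refine this.trans ?_
  rw [← integral_mul_const]
  congr 1
  funext z
  have := J_scale n s (a := 1 + (z + xN0 (n+1)) ^ 2) (by positivity)
  rw [neg_sub, ← this]
  congr 1
  funext y
  congr 1
  ring

lemma K_ident (N : ℕ) (hN : 4 ≤ N) (h : 0 < N) : Kone N h = Ktwo N h + Kthree N h := by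
  obtain ⟨n, rfl⟩ : ∃ n, N = n + 1 := ⟨N - 1, by omega⟩
  have hn : (3 : ℝ) ≤ n := by exact_mod_cast (by omega : 3 ≤ n)
  have hs := sN_pos hN
  obtain ⟨i1, e1⟩ := HS_int n h n (by linarith)
  obtain ⟨i2, e2⟩ := HS_int n h (n + 1) (by linarith)
  have hs2 : sN (n+1) ^ 2 = (n + 1) * (n - 1) := by
    rw [sN, Real.sq_sqrt]
    · push_cast; ring
    · push_cast; nlinarith
  have hx : (n - 1) * xN0 (n+1) = sN (n+1) := by
    have h1 : ((n:ℝ) - 1) = √((n - 1) ^ 2) := (Real.sqrt_sq (by linarith)).symm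
    rw [xN0, h1, ← Real.sqrt_mul (by positivity), sN]
    congr 1
    push_cast
    have : (n : ℝ) + 1 - 2 ≠ 0 := by linarith
    field_simp
    ring
  have U2 : ∀ x : Euc (n+1), ∀ q : ℝ, Ubub (n+1) h 1 x ^ q =
      sN (n+1) ^ (((n:ℝ) - 1) / 2 * q) * Dn (n+1) h 1 x ^ (-(((n:ℝ) - 1) / 2 * q)) := by
    intro x q
    have := Dn_pos h one_pos x
    rw [Ubub_rpow hN h one_pos, one_mul, Real.div_rpow hs.le this.le, Real.rpow_neg this.le,
      div_eq_mul_inv]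
    have : (((n + 1 : ℕ) : ℝ) - 2) / 2 * q = ((n:ℝ) - 1) / 2 * q := by push_cast; ring
    rw [this]
  have k1 : Kone (n+1) h = ((n:ℝ) - 1) ^ 2 * sN (n+1) ^ ((n:ℝ) - 1) *
      ((∫ x in upperHS (n+1) h, Dn (n+1) h 1 x ^ (-(n:ℝ))) -
        ∫ x in upperHS (n+1) h, Dn (n+1) h 1 x ^ (-((n:ℝ) + 1))) := by
    rw [Kone, ← integral_sub i1 i2, ← integral_const_mul]
    congr 1
    funext x
    have hD := Dn_pos h one_pos x
    rw [gradSq_Ubub hN h one_pos, U2, show ((n:ℝ) - 1) / 2 * 2 = (n:ℝ) - 1 by ring]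
    have a1 : Dn (n+1) h 1 x ^ (-((n:ℝ) + 1)) = Dn (n+1) h 1 x ^ (-((n:ℝ) - 1)) / Dn (n+1) h 1 x ^ 2 := by
      rw [← Real.rpow_natCast _ 2, ← Real.rpow_sub hD]; congr 1; push_cast; ring
    have a2 : Dn (n+1) h 1 x ^ (-(n:ℝ)) = Dn (n+1) h 1 x ^ (-((n:ℝ) - 1)) / Dn (n+1) h 1 x := by
      rw [← Real.rpow_sub_one hD.ne']; congr 1; ring
    rw [a1, a2]
    push_cast
    field_simp
    ring
  have k2 : Ktwo (n+1) h = sN (n+1) ^ ((n:ℝ) - 1) * sN (n+1) ^ 2 *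
      ∫ x in upperHS (n+1) h, Dn (n+1) h 1 x ^ (-((n:ℝ) + 1)) := by
    rw [Ktwo, ← integral_const_mul]
    congr 1
    funext x
    have : ((n:ℝ) - 1) / 2 * twoStar (n+1) = n + 1 := by
      have : (n : ℝ) - 1 ≠ 0 := by linarith
      rw [twoStar]; push_cast
      rw [show (n:ℝ) + 1 - 2 = n - 1 by ring]
      field_simp
    rw [U2, this, ← Real.rpow_natCast _ 2, ← Real.rpow_add hs]
    congr 2; push_cast; ring
  have k3 : Kthree (n+1) h = sN (n+1) ^ ((n:ℝ) - 1) * sN (n+1) *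
      ((1 + xN0 (n+1) ^ 2) ^ (-((n:ℝ) / 2)) * ∫ y : Euc n, (1 + ‖y‖ ^ 2) ^ (-(n:ℝ))) := by
    have hJ := J_scale n n (a := 1 + xN0 (n+1) ^ 2) (by positivity)
    rw [show (n:ℝ) / 2 - n = -((n:ℝ)/2) by ring] at hJ
    rw [Kthree, ← hJ, ← integral_const_mul]
    refine integral_congr_ae (Filter.Eventually.of_forall fun y => ?_)
    have : ((n:ℝ) - 1) / 2 * twoStarL (n+1) = n := by
      have : (n : ℝ) - 1 ≠ 0 := by linarith
      rw [twoStarL]; push_cast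
      rw [show (n:ℝ) + 1 - 2 = n - 1 by ring]
      field_simp
      ring
    simp only
    rw [U2, this, ← Real.rpow_add_one hs.ne', Dn_emb]
    congr 2 <;> ring
  have hl := line_ident n hn (xN0 (n+1))
  have hJ2 := J_half n (by omega)
  rw [k1, k2, k3, e1, e2, hJ2, show (n:ℝ) - n / 2 = n / 2 by ring,
    show (n:ℝ) + 1 - n / 2 = n / 2 + 1 by ring] 
  generalize sN (n+1) ^ ((n:ℝ) - 1) = S
  generalize (∫ y : Euc n, (1 + ‖y‖ ^ 2) ^ (-(n:ℝ))) = J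
  generalize (1 + xN0 (n+1) ^ 2) ^ (-((n:ℝ) / 2)) = B at *
  generalize (∫ z in Set.Ioi (0:ℝ), (1 + (z + xN0 (n+1)) ^ 2) ^ (-((n:ℝ) / 2))) = I1 at *
  generalize (∫ z in Set.Ioi (0:ℝ), (1 + (z + xN0 (n+1)) ^ 2) ^ (-((n:ℝ) / 2 + 1))) = I2 at *
  linear_combination S * B * J * hx + S * J * ((n:ℝ) - 1) * hl - S * I2 * J / 2 * hs2


lemma Ut_eq {N : ℕ} (h : 0 < N) (φ : Euc N → ℝ) (ε : ℝ) (x : Euc N) :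
    Ut N h φ ε x = Real.exp (-(1/8) * ‖x‖ ^ 2) * φ x * Ubub N h ε x := by
  rw [Ut, Kw, ← Real.exp_mul]
  congr 3; ring

lemma cutoff_bound {N : ℕ} {φ : Euc N → ℝ} (hφ : IsCutoff N φ) :
    ∃ G : ℝ, 0 ≤ G ∧ ∀ x, ‖fderiv ℝ φ x‖ ≤ G * ‖x‖ := by
  have hc : Continuous (fderiv ℝ φ) := hφ.smooth.continuous_fderiv (by simp)
  have hs : HasCompactSupport φ := by
    apply HasCompactSupport.intro (isCompact_closedBall (0 : Euc N) 2)
    intro x hx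
    exact hφ.eq_zero x (fun h => hx (Metric.ball_subset_closedBall h))
  obtain ⟨G, hG⟩ := hc.bounded_above_of_compact_support (hs.fderiv ℝ)
  have hG0 : 0 ≤ G := (norm_nonneg _).trans (hG 0)
  refine ⟨G, hG0, fun x => ?_⟩
  by_cases hx : ‖x‖ < 1
  · have : φ =ᶠ[𝓝 x] fun _ => 1 := by
      filter_upwards [Metric.isOpen_ball.mem_nhds (show x ∈ Metric.ball (0 : Euc N) 1 by simpa using hx)]
        with y hy
      exact hφ.eq_one y (Metric.ball_subset_closedBall hy)
    rw [this.fderiv_eq]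
    simp
    positivity
  · push Not at hx
    have := hG x
    nlinarith

lemma grad_bound {N : ℕ} (hN : 4 ≤ N) (h : 0 < N) {φ : Euc N → ℝ} (hφ : IsCutoff N φ) :
    ∃ C : ℝ, 0 ≤ C ∧ ∀ ε : ℝ, 0 < ε → ∀ x ∈ upperHS N h,
      Kw x * gradSq (Ut N h φ ε) x ≤ gradSq (Ubub N h ε) x +
        C * (Metric.closedBall (0 : Euc N) 2).indicator (fun x => Ubub N h ε x ^ (2:ℝ)) x := by
  obtain ⟨G, hG0, hG⟩ := cutoff_bound hφ
  have h4 : (4 : ℝ) ≤ N := by exact_mod_cast hN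
  refine ⟨2 * (N - 2) * (G + 1) + 4 * (G + 1) ^ 2, ?_, ?_⟩
  · have : 0 ≤ (N : ℝ) - 2 := by linarith
    positivity
  intro ε hε x hx
  by_cases hxb : x ∈ Metric.closedBall (0 : Euc N) 2
  · rw [Set.indicator_of_mem hxb]
    have hx2 : ‖x‖ ≤ 2 := by simpa using hxb
    have hU := Ubub_pos hN h hε x
    have hD := Dn_pos h hε x
    have hφx := hφ.mem01 x
    have d1 := Ubub_hasFDerivAt hN h hε x
    have d2 : HasFDerivAt φ (fderiv ℝ φ x) x :=
      ((hφ.smooth.differentiable (by simp)) x).hasFDerivAt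
    have d3 : HasFDerivAt (fun x : Euc N => Real.exp (-(1/8) * ‖x‖ ^ 2))
        (Real.exp (-(1/8) * ‖x‖ ^ 2) • ((-(1/8) : ℝ) • (2 • innerSL ℝ x))) x := by
      have := (((hasFDerivAt_id x).norm_sq).const_mul (-(1/8) : ℝ)).exp
      exact this.congr_fderiv (by ext v; simp)
    have d := (d3.mul d2).mul d1
    have hfun : Ut N h φ ε = fun x => Real.exp (-(1/8) * ‖x‖ ^ 2) * φ x * Ubub N h ε x :=
      funext (Ut_eq h φ ε)
    have hd : fderiv ℝ (Ut N h φ ε) x =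
        (Real.exp (-(1/8) * ‖x‖ ^ 2) * φ x) • (fderiv ℝ (Ubub N h ε) x) +
        Ubub N h ε x • (Real.exp (-(1/8) * ‖x‖ ^ 2) • fderiv ℝ φ x +
          φ x • Real.exp (-(1/8) * ‖x‖ ^ 2) • (-(1/8) : ℝ) • (2 • innerSL ℝ x)) := by
      rw [hfun, d1.fderiv]; exact d.fderiv
    set E := Real.exp (-(1/8) * ‖x‖ ^ 2) with hE
    have hE0 : 0 < E := Real.exp_pos _
    have hKE : Kw x * E ^ 2 = 1 := by
      rw [Kw, hE, ← Real.exp_nat_mul, ← Real.exp_add]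
      rw [Real.exp_eq_one_iff]; push_cast; ring
    set a := ‖fderiv ℝ (Ubub N h ε) x‖ with ha
    have ha0 : 0 ≤ a := norm_nonneg _
    have hn : ‖fderiv ℝ (Ut N h φ ε) x‖ ≤ E * (a + Ubub N h ε x * ((G + 1) * ‖x‖)) := by
      rw [hd]
      refine (norm_add_le _ _).trans ?_
      rw [norm_smul, norm_smul, Real.norm_of_nonneg hU.le, Real.norm_of_nonneg
        (mul_nonneg hE0.le hφx.1)]
      have h1 : ‖E • fderiv ℝ φ x + φ x • E • (-(1/8) : ℝ) • (2 • innerSL ℝ x)‖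
          ≤ E * (G * ‖x‖) + E * (1 / 4 * ‖x‖) := by
        refine (norm_add_le _ _).trans ?_
        have e1 : ‖φ x • E • (-(1/8) : ℝ) • (2 • innerSL ℝ x)‖ = φ x * (E * (1 / 4 * ‖x‖)) := by
          have e0 : (-(1/8) : ℝ) • (2 • innerSL ℝ x) = (-(1/4) : ℝ) • innerSL ℝ x := by
            ext v; simp; ring
          have e00 : ‖(-(1/4) : ℝ)‖ = 1 / 4 := by norm_num
          rw [e0, norm_smul, norm_smul, norm_smul, innerSL_apply_norm, Real.norm_of_nonneg hφx.1,
            Real.norm_of_nonneg hE0.le, e00]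
        rw [e1, norm_smul, Real.norm_of_nonneg hE0.le]
        have : φ x * (E * (1 / 4 * ‖x‖)) ≤ 1 * (E * (1 / 4 * ‖x‖)) := by
          gcongr; exact hφx.2
        have := mul_le_mul_of_nonneg_left (hG x) hE0.le
        linarith
      have h2 : E * φ x * a ≤ E * a := by
        have : E * φ x ≤ E * 1 := by gcongr; exact hφx.2
        nlinarith
      have h3 := mul_le_mul_of_nonneg_left h1 hU.le
      have h4 : 0 ≤ Ubub N h ε x * E * ‖x‖ := by positivity
      nlinarith
    have hax : a * ‖x‖ ≤ (N - 2) * Ubub N h ε x := by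
      rw [ha, fderiv_Ubub_norm hN h hε]
      have h1 : ‖x‖ ^ 2 ≤ Dn N h ε x := by
        have := Dn_ge h hε (le_of_lt hx); nlinarith [sq_nonneg ε]
      have h2 : ‖x + bN N h ε‖ ^ 2 ≤ Dn N h ε x := by
        rw [Dn_eq]; nlinarith [sq_nonneg ε]
      have h3 : ‖x + bN N h ε‖ * ‖x‖ ≤ Dn N h ε x := by
        nlinarith [sq_nonneg (‖x + bN N h ε‖ - ‖x‖)]
      have h5 : 0 ≤ (N - 2) * Ubub N h ε x / Dn N h ε x := by
        have : 0 ≤ (N : ℝ) - 2 := by linarith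
        positivity
      calc _ = (N - 2) * Ubub N h ε x / Dn N h ε x * (‖x + bN N h ε‖ * ‖x‖) := by ring
        _ ≤ (N - 2) * Ubub N h ε x / Dn N h ε x * Dn N h ε x := by gcongr
        _ = _ := by field_simp
    rw [gradSq_eq, gradSq_eq, ← ha, Real.rpow_two]
    have hK0 : 0 < Kw x := Real.exp_pos _
    calc Kw x * ‖fderiv ℝ (Ut N h φ ε) x‖ ^ 2
        ≤ Kw x * (E * (a + Ubub N h ε x * ((G + 1) * ‖x‖))) ^ 2 := by gcongr
      _ = (Kw x * E ^ 2) * (a + Ubub N h ε x * ((G + 1) * ‖x‖)) ^ 2 := by ring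
      _ = a ^ 2 + 2 * (G + 1) * Ubub N h ε x * (a * ‖x‖) + (G + 1) ^ 2 * Ubub N h ε x ^ 2 * ‖x‖ ^ 2 := by
        rw [hKE]; ring
      _ ≤ a ^ 2 + 2 * (G + 1) * Ubub N h ε x * ((N - 2) * Ubub N h ε x)
          + (G + 1) ^ 2 * Ubub N h ε x ^ 2 * 2 ^ 2 := by gcongr
      _ = _ := by ring
  · have : Ut N h φ ε =ᶠ[𝓝 x] fun _ => 0 := by
      filter_upwards [Metric.isClosed_closedBall.isOpen_compl.mem_nhds hxb] with y hy
      rw [Ut, hφ.eq_zero y (fun h => hy (Metric.ball_subset_closedBall h))]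
      simp
    rw [Set.indicator_of_notMem hxb, gradSq_eq, this.fderiv_eq, gradSq_eq]
    simp

lemma U2_bound {N : ℕ} (hN : 4 ≤ N) (h : 0 < N) {q : ℝ} (hq : 2 < q) :
    ∃ C : ℝ, 0 ≤ C ∧ ∀ ε : ℝ, 0 < ε → ε ≤ 1 → ∀ x,
      (Metric.closedBall (0 : Euc N) 2).indicator (fun x => Ubub N h ε x ^ (2:ℝ)) x ≤
        C * ε ^ (((N : ℝ) - 2) / 2 * (2 - q)) * Ubub N h ε x ^ q := by
  have h4 : (4 : ℝ) ≤ N := by exact_mod_cast hN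
  have hs := sN_pos hN
  set Λ : ℝ := 1 + (2 + xN0 N) ^ 2 with hΛ
  have hΛ0 : 0 < Λ := by positivity
  refine ⟨(sN N / Λ) ^ (((N : ℝ) - 2) / 2 * (2 - q)), by positivity, ?_⟩
  intro ε hε hε1 x
  have hU := Ubub_pos hN h hε x
  have hD := Dn_pos h hε x
  by_cases hxb : x ∈ Metric.closedBall (0 : Euc N) 2
  · rw [Set.indicator_of_mem hxb]
    have hx2 : ‖x‖ ≤ 2 := by simpa using hxb
    have hb : ‖bN N h ε‖ ≤ xN0 N := by
      have := xN0_nonneg N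
      rw [bN, norm_smul, EuclideanSpace.norm_single, Real.norm_of_nonneg (by positivity)]
      simp
      nlinarith
    have hDL : Dn N h ε x ≤ Λ := by
      rw [Dn_eq, hΛ]
      have : ‖x + bN N h ε‖ ≤ 2 + xN0 N := (norm_add_le _ _).trans (add_le_add hx2 hb)
      gcongr
      nlinarith
    have e : (2:ℝ) = (2 - q) + q := by ring
    rw [e, Real.rpow_add hU, sub_add_cancel, ← Real.mul_rpow (by positivity) hε.le]
    gcongr
    rw [Ubub_rpow hN h hε]
    apply Real.rpow_le_rpow_of_nonpos (by positivity)
    · rw [div_mul_eq_mul_div, mul_comm]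
      gcongr
    · nlinarith
  · rw [Set.indicator_of_notMem hxb]
    positivity

lemma E1 {N : ℕ} (hN : 4 ≤ N) (h : 0 < N) {φ : Euc N → ℝ} (hφ : IsCutoff N φ) {q : ℝ} (hq : 2 < q) :
    ∃ C : ℝ, 0 ≤ C ∧ ∀ ε : ℝ, 0 < ε → ε ≤ 1 →
      ∫ x in upperHS N h, Kw x * gradSq (Ut N h φ ε) x ≤
        Kone N h + C * ε ^ ((N : ℝ) - ((N : ℝ) - 2) * (q - 1)) := by
  obtain ⟨C1, hC1, H1⟩ := grad_bound hN h hφ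
  obtain ⟨C2, hC2, H2⟩ := U2_bound hN h hq
  have hI0 : 0 ≤ ∫ x in upperHS N h, Ubub N h 1 x ^ q :=
    integral_nonneg fun x => Real.rpow_nonneg (Ubub_pos hN h one_pos x).le _
  refine ⟨C1 * C2 * ∫ x in upperHS N h, Ubub N h 1 x ^ q, by positivity, ?_⟩
  intro ε hε hε1
  have i1 := grad_integrable hN h hε hε1
  have i2 := (U_integrable hN h hε hε1 hq).const_mul
    (C1 * (C2 * ε ^ (((N : ℝ) - 2) / 2 * (2 - q))))
  calc _ ≤ ∫ x in upperHS N h, (gradSq (Ubub N h ε) x +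
        (C1 * (C2 * ε ^ (((N : ℝ) - 2) / 2 * (2 - q)))) * Ubub N h ε x ^ q) := by
        apply integral_mono_of_nonneg
        · refine Filter.Eventually.of_forall fun x => ?_
          change 0 ≤ Kw x * gradSq (Ut N h φ ε) x
          rw [gradSq_eq, Kw]; positivity
        · exact i1.add i2
        · filter_upwards [ae_restrict_mem (upperHS_meas h)] with x hx
          refine (H1 ε hε x hx).trans ?_
          have := mul_le_mul_of_nonneg_left (H2 ε hε hε1 x) hC1
          linarith
    _ = Kone N h + C1 * (C2 * ε ^ (((N : ℝ) - 2) / 2 * (2 - q))) *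
        (ε ^ ((N : ℝ) - ((N : ℝ) - 2) / 2 * q) * ∫ x in upperHS N h, Ubub N h 1 x ^ q) := by
        rw [integral_add i1 i2, int_grad_scale hN h hε, integral_const_mul, int_U_scale hN h hε]
    _ = _ := by
        have : (N : ℝ) - ((N : ℝ) - 2) * (q - 1) = ((N : ℝ) - 2) / 2 * (2 - q) +
          ((N : ℝ) - ((N : ℝ) - 2) / 2 * q) := by ring
        rw [this, Real.rpow_add hε]
        ring

lemma KUt_eq {N : ℕ} (hN : 4 ≤ N) (h : 0 < N) {φ : Euc N → ℝ} (hφ : IsCutoff N φ) {ε : ℝ}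
    (hε : 0 < ε) (r : ℝ) (x : Euc N) :
    Kw x * Ut N h φ ε x ^ r =
      Real.exp (-((r / 2 - 1) / 4 * ‖x‖ ^ 2)) * φ x ^ r * Ubub N h ε x ^ r := by
  have hU := Ubub_pos hN h hε x
  have hφx := hφ.mem01 x
  rw [Ut_eq, Real.mul_rpow (mul_nonneg (Real.exp_pos _).le hφx.1) hU.le,
    Real.mul_rpow (Real.exp_pos _).le hφx.1, ← Real.exp_mul, Kw, ← mul_assoc, ← mul_assoc,
    ← Real.exp_add]
  congr 3; ring

lemma KUt_le {N : ℕ} (hN : 4 ≤ N) (h : 0 < N) {φ : Euc N → ℝ} (hφ : IsCutoff N φ) {ε : ℝ}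
    (hε : 0 < ε) {r : ℝ} (hr : 2 < r) (x : Euc N) :
    ‖Kw x * Ut N h φ ε x ^ r‖ ≤ Ubub N h ε x ^ r := by
  have hU := Ubub_pos hN h hε x
  have hφx := hφ.mem01 x
  have hp : 0 ≤ φ x ^ r := Real.rpow_nonneg hφx.1 _
  rw [KUt_eq hN h hφ hε, Real.norm_of_nonneg (by positivity)]
  have h1 : Real.exp (-((r / 2 - 1) / 4 * ‖x‖ ^ 2)) ≤ 1 := by
    rw [Real.exp_le_one_iff]
    have : 0 ≤ (r / 2 - 1) / 4 := by linarith
    have : 0 ≤ (r / 2 - 1) / 4 * ‖x‖ ^ 2 := by positivity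
    linarith
  have h2 : φ x ^ r ≤ 1 := Real.rpow_le_one hφx.1 hφx.2 (by linarith)
  have h3 := mul_le_one₀ h1 hp h2
  have : 0 ≤ Ubub N h ε x ^ r := by positivity
  nlinarith

lemma KUt_cont {N : ℕ} (hN : 4 ≤ N) (h : 0 < N) {φ : Euc N → ℝ} (hφ : IsCutoff N φ) {ε : ℝ}
    (hε : 0 < ε) {r : ℝ} (hr : 2 < r) : Continuous fun x => Kw x * Ut N h φ ε x ^ r := by
  simp_rw [KUt_eq hN h hφ hε]
  have c1 : Continuous fun x => φ x ^ r :=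
    hφ.smooth.continuous.rpow_const (fun x => Or.inr (by linarith))
  have c2 : Continuous fun x => Ubub N h ε x ^ r :=
    (Ubub_cont hN h hε).rpow_const (fun x => Or.inr (by linarith))
  fun_prop

lemma KUt_ge {N : ℕ} (hN : 4 ≤ N) (h : 0 < N) {φ : Euc N → ℝ} (hφ : IsCutoff N φ) {ε : ℝ}
    (hε : 0 < ε) {r : ℝ} (hr : 2 < r) {x : Euc N} (hx : 0 ≤ x (lastIdx N h)) :
    Ubub N h ε x ^ r - r * (ε * sN N) * Ubub N h ε x ^ (r - 2 / ((N : ℝ) - 2)) ≤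
      Kw x * Ut N h φ ε x ^ r := by
  have hU := Ubub_pos hN h hε x
  have hφx := hφ.mem01 x
  have hp : 0 ≤ φ x ^ r := Real.rpow_nonneg hφx.1 _
  have hUr : 0 < Ubub N h ε x ^ r := by positivity
  rw [mul_assoc, ← Dn_mul_U hN h hε, KUt_eq hN h hφ hε]
  have hD : ‖x‖ ^ 2 ≤ Dn N h ε x := by
    have := Dn_ge h hε hx; nlinarith [sq_nonneg ε]
  have hm := mul_le_mul_of_nonneg_right hD hUr.le
  have key : 1 - r * ‖x‖ ^ 2 ≤ Real.exp (-((r / 2 - 1) / 4 * ‖x‖ ^ 2)) * φ x ^ r := by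
    by_cases hx1 : ‖x‖ ≤ 1
    · rw [hφ.eq_one x (by simpa using hx1), Real.one_rpow, mul_one]
      have := Real.add_one_le_exp (-((r / 2 - 1) / 4 * ‖x‖ ^ 2))
      nlinarith [sq_nonneg ‖x‖]
    · push Not at hx1
      have : 0 ≤ Real.exp (-((r / 2 - 1) / 4 * ‖x‖ ^ 2)) * φ x ^ r := by positivity
      nlinarith
  have := mul_le_mul_of_nonneg_right key hUr.le
  nlinarith

lemma twoStarL_gt {N : ℕ} (hN : 4 ≤ N) : 2 < twoStarL N := by
  have h4 : (4 : ℝ) ≤ N := by exact_mod_cast hN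
  rw [twoStarL, lt_div_iff₀ (by linarith)]; linarith

lemma twoStar_gt {N : ℕ} (hN : 4 ≤ N) : 2 < twoStar N := by
  have h4 : (4 : ℝ) ≤ N := by exact_mod_cast hN
  rw [twoStar, lt_div_iff₀ (by linarith)]; linarith

lemma KUt_int {N : ℕ} (hN : 4 ≤ N) (h : 0 < N) {φ : Euc N → ℝ} (hφ : IsCutoff N φ) {ε : ℝ}
    (hε : 0 < ε) (hε1 : ε ≤ 1) {r : ℝ} (hr : 2 < r) :
    IntegrableOn (fun x => Kw x * Ut N h φ ε x ^ r) (upperHS N h) :=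
  Integrable.mono' (U_integrable hN h hε hε1 hr) (KUt_cont hN h hφ hε hr).aestronglyMeasurable
    (Filter.Eventually.of_forall fun x => KUt_le hN h hφ hε hr x)

lemma E2 {N : ℕ} (hN : 4 ≤ N) (h : 0 < N) {φ : Euc N → ℝ} (hφ : IsCutoff N φ) :
    ∃ C : ℝ, 0 ≤ C ∧ ∀ ε : ℝ, 0 < ε → ε ≤ 1 →
      Ktwo N h - C * ε ^ 2 ≤ ∫ x in upperHS N h, Kw x * Ut N h φ ε x ^ twoStar N := by
  have h4 : (4 : ℝ) ≤ N := by exact_mod_cast hN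
  have hm : (N : ℝ) - 2 ≠ 0 := by linarith
  have hs := sN_pos hN
  have hI0 : 0 ≤ ∫ x in upperHS N h, Ubub N h 1 x ^ twoStarL N :=
    integral_nonneg fun x => Real.rpow_nonneg (Ubub_pos hN h one_pos x).le _
  have ht := twoStar_gt hN
  refine ⟨twoStar N * sN N * ∫ x in upperHS N h, Ubub N h 1 x ^ twoStarL N, by positivity, ?_⟩
  intro ε hε hε1
  have e : twoStar N - 2 / ((N : ℝ) - 2) = twoStarL N := by
    rw [twoStar, twoStarL]; field_simp
  have i1 := U_integrable hN h hε hε1 ht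
  have i2 := (U_integrable hN h hε hε1 (twoStarL_gt hN)).const_mul (twoStar N * (ε * sN N))
  have : ∫ x in upperHS N h, (Ubub N h ε x ^ twoStar N -
      twoStar N * (ε * sN N) * Ubub N h ε x ^ twoStarL N) ≤
      ∫ x in upperHS N h, Kw x * Ut N h φ ε x ^ twoStar N := by
    apply setIntegral_mono_on (i1.sub i2) (KUt_int hN h hφ hε hε1 ht) (upperHS_meas h)
    intro x hx
    have := KUt_ge hN h hφ hε ht (le_of_lt hx)
    rwa [e] at this
  refine le_trans (le_of_eq ?_) this
  rw [integral_sub i1 i2, integral_const_mul, int_U_scale hN h hε, int_U_scale hN h hε, ← Ktwo]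
  have e1 : (N : ℝ) - ((N : ℝ) - 2) / 2 * twoStar N = 0 := by
    rw [twoStar]; field_simp; ring
  have e2 : (N : ℝ) - ((N : ℝ) - 2) / 2 * twoStarL N = 1 := by
    rw [twoStarL]; field_simp; ring
  rw [e1, e2, Real.rpow_zero, Real.rpow_one]
  ring

lemma E3 {N : ℕ} (hN : 4 ≤ N) (h : 0 < N) {φ : Euc N → ℝ} (hφ : IsCutoff N φ) :
    ∃ C : ℝ, 0 ≤ C ∧ ∀ ε : ℝ, 0 < ε → ε ≤ 1 →
      Kthree N h - C * ε ^ 2 ≤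
        ∫ y : Euc (N - 1), Kw (emb N y) * Ut N h φ ε (emb N y) ^ twoStarL N := by
  have h4 : (4 : ℝ) ≤ N := by exact_mod_cast hN
  have hm : (N : ℝ) - 2 ≠ 0 := by linarith
  have hs := sN_pos hN
  have hI0 : 0 ≤ ∫ y, Ubub N h 1 (emb N y) ^ (2:ℝ) :=
    integral_nonneg fun x => Real.rpow_nonneg (Ubub_pos hN h one_pos _).le _
  have ht := twoStarL_gt hN
  refine ⟨twoStarL N * sN N * ∫ y, Ubub N h 1 (emb N y) ^ (2:ℝ), by positivity, ?_⟩
  intro ε hε hε1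
  have e : twoStarL N - 2 / ((N : ℝ) - 2) = 2 := by
    rw [twoStarL]; field_simp; ring
  have i1 := bU_integrable hN h hε hε1 ht.le
  have i2 := (bU_integrable hN h hε hε1 le_rfl).const_mul (twoStarL N * (ε * sN N))
  have i3 : Integrable (fun y => Kw (emb N y) * Ut N h φ ε (emb N y) ^ twoStarL N) :=
    Integrable.mono' i1 ((KUt_cont hN h hφ hε ht).comp (emb_cont N)).aestronglyMeasurable
      (Filter.Eventually.of_forall fun x => KUt_le hN h hφ hε ht _)
  have : ∫ y, (Ubub N h ε (emb N y) ^ twoStarL N -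
      twoStarL N * (ε * sN N) * Ubub N h ε (emb N y) ^ (2:ℝ)) ≤
      ∫ y : Euc (N - 1), Kw (emb N y) * Ut N h φ ε (emb N y) ^ twoStarL N := by
    apply integral_mono (i1.sub i2) i3
    intro y
    have := KUt_ge hN h hφ hε ht (emb_last h y).ge
    rwa [e] at this
  refine le_trans (le_of_eq ?_) this
  rw [integral_sub i1 i2, integral_const_mul, int_bU_scale hN h hε, int_bU_scale hN h hε, ← Kthree]
  have e1 : (N : ℝ) - 1 - ((N : ℝ) - 2) / 2 * twoStarL N = 0 := by
    rw [twoStarL]; field_simp; ring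
  have e2 : (N : ℝ) - 1 - ((N : ℝ) - 2) / 2 * 2 = 1 := by ring
  rw [e1, e2, Real.rpow_zero, Real.rpow_one]
  ring

lemma pos_ball {N : ℕ} (hN : 4 ≤ N) (h : 0 < N) {q : ℝ} (hq : 2 < q) :
    0 < ∫ x in upperHS N h, (Metric.ball (0 : Euc N) 1).indicator (fun x => Ubub N h 1 x ^ q) x := by
  rw [setIntegral_indicator measurableSet_ball]
  have hne : ((Metric.ball (0 : Euc N) 1) ∩ upperHS N h).Nonempty := by
    refine ⟨EuclideanSpace.single (lastIdx N h) (1/2), ?_, ?_⟩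
    · simp; norm_num
    · simp [upperHS]
  have ho : IsOpen (upperHS N h ∩ Metric.ball (0 : Euc N) 1) := by
    apply IsOpen.inter _ Metric.isOpen_ball
    exact isOpen_lt continuous_const (by fun_prop)
  rw [setIntegral_pos_iff_support_of_nonneg_ae]
  · have : (Function.support fun x => Ubub N h 1 x ^ q) = Set.univ := by
      ext x
      have := Ubub_pos hN h one_pos x
      simp only [Function.mem_support, Set.mem_univ, iff_true]
      positivity
    rw [this, Set.univ_inter]
    exact ho.measure_pos _ (by rwa [Set.inter_comm] at hne)
  · exact Filter.Eventually.of_forall fun x => Real.rpow_nonneg (Ubub_pos hN h one_pos x).le _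
  · exact (U_integrable hN h one_pos le_rfl hq).mono_set Set.inter_subset_left

lemma Ktwo_pos {N : ℕ} (hN : 4 ≤ N) (h : 0 < N) : 0 < Ktwo N h := by
  refine (pos_ball hN h (twoStar_gt hN)).trans_le ?_
  have i := U_integrable hN h one_pos le_rfl (twoStar_gt hN)
  apply setIntegral_mono_on (i.indicator measurableSet_ball) i (upperHS_meas h)
  intro x _
  exact Set.indicator_le_self' (fun _ _ => Real.rpow_nonneg (Ubub_pos hN h one_pos _).le _) _

lemma Kthree_nonneg {N : ℕ} (hN : 4 ≤ N) (h : 0 < N) : 0 ≤ Kthree N h :=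
  integral_nonneg fun x => Real.rpow_nonneg (Ubub_pos hN h one_pos _).le _

lemma E4 {N : ℕ} (hN : 4 ≤ N) (h : 0 < N) {φ : Euc N → ℝ} (hφ : IsCutoff N φ) {p : ℝ} (hp : 2 < p) :
    ∃ c : ℝ, 0 < c ∧ ∀ ε : ℝ, 0 < ε → ε ≤ 1 →
      c * ε ^ ((N : ℝ) - ((N : ℝ) - 2) / 2 * p) ≤
        ∫ x in upperHS N h, Kw x * Ut N h φ ε x ^ p := by
  refine ⟨Real.exp (-((p / 2 - 1) / 4)) *
    ∫ x in upperHS N h, (Metric.ball (0 : Euc N) 1).indicator (fun x => Ubub N h 1 x ^ p) x,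
    mul_pos (Real.exp_pos _) (pos_ball hN h hp), ?_⟩
  intro ε hε hε1
  have i1 := U_integrable hN h hε hε1 hp
  have i0 := U_integrable hN h one_pos le_rfl hp
  have s1 : ∫ x in upperHS N h, Real.exp (-((p / 2 - 1) / 4)) *
      (Metric.ball (0 : Euc N) 1).indicator (fun x => Ubub N h ε x ^ p) x ≤
      ∫ x in upperHS N h, Kw x * Ut N h φ ε x ^ p := by
    apply setIntegral_mono_on _ (KUt_int hN h hφ hε hε1 hp) (upperHS_meas h)
    · intro x _
      have hU := Ubub_pos hN h hε x
      have hp : 0 ≤ φ x ^ p := Real.rpow_nonneg (hφ.mem01 x).1 _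
      rw [KUt_eq hN h hφ hε]
      by_cases hx : x ∈ Metric.ball (0 : Euc N) 1
      · rw [Set.indicator_of_mem hx, hφ.eq_one x (Metric.ball_subset_closedBall hx),
          Real.one_rpow, mul_one]
        have hx1 : ‖x‖ < 1 := by simpa using hx
        gcongr
        have : 0 ≤ (p / 2 - 1) / 4 := by linarith
        have : ‖x‖ ^ 2 ≤ 1 := by nlinarith [norm_nonneg x]
        nlinarith
      · rw [Set.indicator_of_notMem hx, mul_zero]
        positivity
    · exact (i1.indicator measurableSet_ball).const_mul _
  refine le_trans ?_ s1
  rw [integral_const_mul, mul_assoc]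
  gcongr
  rw [setInt_scale h hε (fun x => (Metric.ball (0 : Euc N) 1).indicator (fun x => Ubub N h ε x ^ p) x)]
  have e : ∀ x : Euc N, (Metric.ball (0 : Euc N) 1).indicator (fun x => Ubub N h ε x ^ p) (ε • x) =
      ε ^ (-(((N : ℝ) - 2) / 2 * p)) *
        (Metric.ball (0 : Euc N) ε⁻¹).indicator (fun x => Ubub N h 1 x ^ p) x := by
    intro x
    have : ε • x ∈ Metric.ball (0 : Euc N) 1 ↔ x ∈ Metric.ball (0 : Euc N) ε⁻¹ := by
      simp only [mem_ball_zero_iff, norm_smul, Real.norm_of_nonneg hε.le]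
      rw [← lt_inv_mul_iff₀ hε, mul_one]
    by_cases hx : x ∈ Metric.ball (0 : Euc N) ε⁻¹
    · rw [Set.indicator_of_mem hx, Set.indicator_of_mem (this.2 hx), Ubub_smul hN h hε]
    · rw [Set.indicator_of_notMem hx, Set.indicator_of_notMem (fun hh => hx (this.1 hh)), mul_zero]
  simp_rw [e]
  rw [integral_const_mul, ← mul_assoc, ← Real.rpow_natCast, ← Real.rpow_add hε, mul_comm,
    ← sub_eq_add_neg]
  refine mul_le_mul_of_nonneg_left ?_ (by positivity)
  apply setIntegral_mono_on (i0.indicator measurableSet_ball) (i0.indicator measurableSet_ball)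
    (upperHS_meas h)
  intro x _
  apply Set.indicator_le_indicator_of_subset
  · exact Metric.ball_subset_ball ((one_le_inv₀ hε).2 hε1)
  · intro x
    exact Real.rpow_nonneg (Ubub_pos hN h one_pos x).le _


lemma one_pt {t r : ℝ} (ht : 0 < t) (hr : 2 < r) : t ^ 2 / 2 - t ^ r / r ≤ 1 / 2 - 1 / r := by
  have h1 := one_add_mul_self_le_rpow_one_add (s := t ^ 2 - 1) (p := r / 2)
    (by nlinarith [sq_nonneg t]) (by linarith)
  have h2 : (1 + (t ^ 2 - 1)) ^ (r / 2) = t ^ r := by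
    rw [add_sub_cancel, ← Real.rpow_natCast, ← Real.rpow_mul ht.le]
    congr 1; push_cast; ring
  rw [h2] at h1
  have h3 : (1 + r / 2 * (t ^ 2 - 1)) / r ≤ t ^ r / r := by
    have : 0 < r := by linarith
    gcongr
  have h4 : (1 + r / 2 * (t ^ 2 - 1)) / r = 1 / r + (t ^ 2 - 1) / 2 := by
    have : r ≠ 0 := by linarith
    field_simp
  linarith

lemma abs_main {K1 K2 K3 r s p σ θ C c b : ℝ} {a P Q R : ℝ → ℝ}
    (hK : K1 = K2 + K3) (hK2 : 0 < K2) (hK3 : 0 ≤ K3) (hr : 2 < r) (hs : 2 < s) (hp : 2 < p)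
    (hC : 0 ≤ C) (hc : 0 < c) (hb : 0 < b) (hθ : θ < σ) (hσ : 0 < σ)
    (ha : ∀ ε, 0 < ε → ε ≤ 1 → a ε ≤ K1 + C * ε ^ σ)
    (hP : ∀ ε, 0 < ε → ε ≤ 1 → c * ε ^ θ ≤ P ε)
    (hQ : ∀ ε, 0 < ε → ε ≤ 1 → K2 - C * ε ^ σ ≤ Q ε)
    (hR : ∀ ε, 0 < ε → ε ≤ 1 → K3 - C * ε ^ σ ≤ R ε)
    (hR0 : ∀ ε, 0 < ε → ε ≤ 1 → 0 ≤ R ε) :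
    ∃ ε₀ : ℝ, 0 < ε₀ ∧ ∀ ε : ℝ, 0 < ε → ε < ε₀ →
      ∃ M : ℝ, M < K1 / 2 - K2 / r - K3 / s ∧ ∀ t : ℝ, 0 < t →
        (t ^ 2 / 2) * a ε - (b * t ^ p / p) * P ε - (t ^ r / r) * Q ε - (t ^ s / s) * R ε ≤ M := by
  have hr0 : 0 < r := by linarith
  have hs0 : 0 < s := by linarith
  have hp0 : 0 < p := by linarith
  have hK1 : 0 < K1 := by linarith
  set A := K1 / 2 - K2 / r - K3 / s with hA
  have hA0 : 0 < A := by
    have e1 : 0 < 1 / 2 - 1 / r := by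
      rw [sub_pos]; exact one_div_lt_one_div_of_lt (by norm_num) hr
    have e2 : 0 < 1 / 2 - 1 / s := by
      rw [sub_pos]; exact one_div_lt_one_div_of_lt (by norm_num) hs
    have : A = K2 * (1 / 2 - 1 / r) + K3 * (1 / 2 - 1 / s) := by rw [hA, hK]; ring
    rw [this]; positivity
  -- small and large values of t
  set t0 := Real.sqrt (A / 2 / K1) with ht0
  have ht0p : 0 < t0 := Real.sqrt_pos.2 (by positivity)
  have ht0s : t0 ^ 2 * K1 = A / 2 := by
    rw [ht0, Real.sq_sqrt (by positivity)]; field_simp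
  obtain ⟨T, hT1, hT⟩ : ∃ T : ℝ, 0 < T ∧ ∀ t, T ≤ t → 2 * r * K1 / K2 ≤ t ^ (r - 2) := by
    have := (tendsto_rpow_atTop (show 0 < r - 2 by linarith)).eventually_ge_atTop (2 * r * K1 / K2)
    obtain ⟨T, hT⟩ := eventually_atTop.1 this
    exact ⟨max T 1, by positivity, fun t ht => hT t (le_trans (le_max_left _ _) ht)⟩
  set CT := T ^ 2 / 2 + T ^ r / r + T ^ s / s with hCT
  have hCT0 : 0 ≤ CT := by positivity
  set d := b * t0 ^ p / p * c with hd
  have hd0 : 0 < d := by positivity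
  have lim : ∀ {x : ℝ}, 0 < x → Tendsto (fun ε : ℝ => ε ^ x) (𝓝[>] 0) (𝓝 0) := by
    intro x hx
    have := (Real.continuousAt_rpow_const 0 x (Or.inr hx.le)).tendsto
    rw [Real.zero_rpow hx.ne'] at this
    exact this.mono_left nhdsWithin_le_nhds
  have l1 : Tendsto (fun ε : ℝ => C * ε ^ σ) (𝓝[>] 0) (𝓝 0) := by
    simpa using (lim hσ).const_mul C
  have l2 : Tendsto (fun ε : ℝ => C * CT * ε ^ (σ - θ)) (𝓝[>] 0) (𝓝 0) := by
    simpa using (lim (sub_pos.2 hθ)).const_mul (C * CT)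
  have l3 : ∀ᶠ ε : ℝ in 𝓝[>] 0, ε < 1 :=
    nhdsWithin_le_nhds (eventually_lt_nhds one_pos)
  have ev := (((l1.eventually (eventually_lt_nhds hK1)).and
    (l1.eventually (eventually_lt_nhds (half_pos hK2)))).and
    (l2.eventually (eventually_lt_nhds hd0))).and l3
  obtain ⟨ε₀, hε₀, hev⟩ := mem_nhdsGT_iff_exists_Ioo_subset.1 ev
  refine ⟨ε₀, hε₀, fun ε hε hεl => ?_⟩
  obtain ⟨⟨⟨h1, h2⟩, h3⟩, h4⟩ := hev ⟨hε, hεl⟩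
  have ha := ha ε hε h4.le
  have hP := hP ε hε h4.le
  have hQ := hQ ε hε h4.le
  have hR := hR ε hε h4.le
  have hR0 := hR0 ε hε h4.le
  have hpow : ε ^ σ = ε ^ (σ - θ) * ε ^ θ := by rw [← Real.rpow_add hε]; congr 1; ring
  have hθp : 0 < ε ^ θ := Real.rpow_pos_of_pos hε _
  set η := C * ε ^ σ with hη
  have hη0 : 0 ≤ η := by positivity
  have h5 : η * CT < d * ε ^ θ := by
    rw [hη, hpow]
    have := mul_lt_mul_of_pos_right h3 hθp
    linarith
  have hP0 : 0 ≤ P ε := le_trans (by positivity) hP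
  have hQ0 : K2 / 2 ≤ Q ε := by linarith
  refine ⟨max (A / 2) (A + (η * CT - d * ε ^ θ)), max_lt (by linarith) (by linarith), ?_⟩
  intro t ht
  have tp : 0 < t ^ p := Real.rpow_pos_of_pos ht _
  have tr : 0 < t ^ r := Real.rpow_pos_of_pos ht _
  have ts : 0 < t ^ s := Real.rpow_pos_of_pos ht _
  have n1 : 0 ≤ (b * t ^ p / p) * P ε := by positivity
  have n3 : 0 ≤ (t ^ s / s) * R ε := by positivity
  have n2 : t ^ r / r * (K2 / 2) ≤ (t ^ r / r) * Q ε := by gcongr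
  have n2' : 0 ≤ t ^ r / r * (K2 / 2) := by positivity
  have n4 : (t ^ 2 / 2) * a ε ≤ t ^ 2 * K1 := by
    have : t ^ 2 / 2 * a ε ≤ t ^ 2 / 2 * (2 * K1) := by gcongr; linarith
    linarith
  rcases lt_or_ge t t0 with c1 | c1
  · refine le_trans ?_ (le_max_left _ _)
    have : t ^ 2 * K1 ≤ t0 ^ 2 * K1 := by gcongr
    linarith
  rcases le_or_gt T t with c2 | c2
  · refine le_trans ?_ (le_max_left _ _)
    have e1 := hT t c2
    have e2 : t ^ r = t ^ (r - 2) * t ^ 2 := by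
      rw [← Real.rpow_natCast t 2, ← Real.rpow_add ht]; congr 1; push_cast; ring
    have e3 : t ^ 2 * K1 ≤ t ^ r / r * (K2 / 2) := by
      rw [e2]
      calc t ^ 2 * K1 = (2 * r * K1 / K2) * t ^ 2 / r * (K2 / 2) := by field_simp
        _ ≤ _ := by gcongr
    linarith
  · refine le_trans ?_ (le_max_right _ _)
    have m1 : t ^ 2 / 2 * a ε ≤ t ^ 2 / 2 * (K1 + η) := by gcongr
    have m2 : t ^ r / r * (K2 - η) ≤ t ^ r / r * Q ε := by gcongr
    have m3 : t ^ s / s * (K3 - η) ≤ t ^ s / s * R ε := by gcongr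
    have m4 : d * ε ^ θ ≤ (b * t ^ p / p) * P ε := by
      calc d * ε ^ θ = b * t0 ^ p / p * (c * ε ^ θ) := by rw [hd]; ring
        _ ≤ _ := by gcongr
    have m5 : t ^ 2 / 2 + t ^ r / r + t ^ s / s ≤ CT := by rw [hCT]; gcongr
    have m6 := mul_le_mul_of_nonneg_left m5 hη0
    have m7 := mul_le_mul_of_nonneg_left (one_pt ht hr) hK2.le
    have m8 := mul_le_mul_of_nonneg_left (one_pt ht hs) hK3
    have m9 : t ^ 2 / 2 * K1 - t ^ r / r * K2 - t ^ s / s * K3 ≤ A := by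
      have : A = K2 * (1 / 2 - 1 / r) + K3 * (1 / 2 - 1 / s) := by rw [hA, hK]; ring
      rw [this, hK]; linarith
    linarith

/-- Lemma 3.8, `N ≥ 4`: the mountain-pass level along the truncated bubble
stays strictly below the threshold `A = K₁/2 - K₂/2* - K₃/2_*` for `ε` small. -/
theorem statement18 (N : ℕ) (hN : 4 ≤ N) (p lam mu : ℝ)
    (hp1 : 2 < p) (hp2 : p < twoStar N) (hlam : 0 < lam) (hmu : 0 < mu)
    (φ : Euc N → ℝ) (hφ : IsCutoff N φ) :
    ∃ ε₀ : ℝ, 0 < ε₀ ∧ ∀ ε : ℝ, 0 < ε → ε < ε₀ →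
      ∃ M : ℝ,
        M < Kone N (by omega) / 2 - Ktwo N (by omega) / twoStar N
              - Kthree N (by omega) / twoStarL N ∧
        ∀ t : ℝ, 0 < t →
          (t ^ 2 / 2) *
              (∫ x in upperHS N (by omega : 0 < N), Kw x * gradSq (Ut N (by omega) φ ε) x)
            - (mu * lam ^ ((((N : ℝ) - 2) * (2 - p)) / 4) * t ^ p / p) *
                (∫ x in upperHS N (by omega : 0 < N), Kw x * (Ut N (by omega) φ ε x) ^ p)
            - (t ^ twoStar N / twoStar N) *
                (∫ x in upperHS N (by omega : 0 < N),
                  Kw x * (Ut N (by omega) φ ε x) ^ twoStar N)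
            - (t ^ twoStarL N / twoStarL N) *
                (∫ y : Euc (N - 1),
                  Kw (emb N y) * (Ut N (by omega) φ ε (emb N y)) ^ twoStarL N)
          ≤ M := by
  have h : 0 < N := by omega
  have h4 : (4 : ℝ) ≤ N := by exact_mod_cast hN
  have hn2 : 0 < (N : ℝ) - 2 := by linarith
  have hpN : ((N : ℝ) - 2) * (p - 2) < 4 := by
    rw [twoStar, lt_div_iff₀ hn2] at hp2
    linarith
  have hpN0 : 0 < ((N : ℝ) - 2) * (p - 2) := mul_pos hn2 (by linarith)
  obtain ⟨C1, hC1, H1⟩ := E1 hN h hφ (q := 2 + (p - 2) / 4) (by linarith)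
  obtain ⟨C2, hC2, H2⟩ := E2 hN h hφ
  obtain ⟨C3, hC3, H3⟩ := E3 hN h hφ
  obtain ⟨c, hc, H4⟩ := E4 hN h hφ hp1
  have hσ2 : ((N : ℝ) - ((N : ℝ) - 2) * (2 + (p - 2) / 4 - 1)) ≤ 2 := by linarith
  have hsq : ∀ ε : ℝ, 0 < ε → ε ≤ 1 →
      ε ^ 2 ≤ ε ^ ((N : ℝ) - ((N : ℝ) - 2) * (2 + (p - 2) / 4 - 1)) := by
    intro ε hε hε1
    rw [← Real.rpow_two]
    exact Real.rpow_le_rpow_of_exponent_ge hε hε1 hσ2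
  refine abs_main (σ := (N : ℝ) - ((N : ℝ) - 2) * (2 + (p - 2) / 4 - 1))
    (θ := (N : ℝ) - ((N : ℝ) - 2) / 2 * p) (C := C1 + C2 + C3) (c := c)
    (a := fun ε => ∫ x in upperHS N h, Kw x * gradSq (Ut N h φ ε) x)
    (P := fun ε => ∫ x in upperHS N h, Kw x * (Ut N h φ ε x) ^ p)
    (Q := fun ε => ∫ x in upperHS N h, Kw x * (Ut N h φ ε x) ^ twoStar N)
    (R := fun ε => ∫ y : Euc (N - 1), Kw (emb N y) * (Ut N h φ ε (emb N y)) ^ twoStarL N)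
    (K_ident N hN h) (Ktwo_pos hN h) (Kthree_nonneg hN h) (twoStar_gt hN) (twoStarL_gt hN) hp1
    (by positivity) hc (mul_pos hmu (Real.rpow_pos_of_pos hlam _)) (by linarith) (by linarith)
    ?_ H4 ?_ ?_ ?_
  · intro ε hε hε1
    have := H1 ε hε hε1
    have hpos := Real.rpow_pos_of_pos hε ((N : ℝ) - ((N : ℝ) - 2) * (2 + (p - 2) / 4 - 1))
    have := mul_nonneg (add_nonneg hC2 hC3) hpos.le
    linarith
  · intro ε hε hε1
    have := H2 ε hε hε1
    have hpos := Real.rpow_pos_of_pos hε ((N : ℝ) - ((N : ℝ) - 2) * (2 + (p - 2) / 4 - 1))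
    have := mul_nonneg (add_nonneg hC1 hC3) hpos.le
    have := mul_le_mul_of_nonneg_left (hsq ε hε hε1) hC2
    linarith
  · intro ε hε hε1
    have := H3 ε hε hε1
    have hpos := Real.rpow_pos_of_pos hε ((N : ℝ) - ((N : ℝ) - 2) * (2 + (p - 2) / 4 - 1))
    have := mul_nonneg (add_nonneg hC1 hC2) hpos.le
    have := mul_le_mul_of_nonneg_left (hsq ε hε hε1) hC3
    linarith
  · intro ε hε hε1
    refine integral_nonneg fun y => mul_nonneg (Real.exp_pos _).le (Real.rpow_nonneg ?_ _)
    exact mul_nonneg (mul_nonneg (Real.rpow_nonneg (Real.exp_pos _).le _) (hφ.mem01 _).1)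
      (Ubub_pos hN h hε _).le
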